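/- Let α > 0 and τ ∈ ℝ \ {0}. Then for every x > 0, ∫_{√x}^∞ [K_{α+iτ}(y) I_{α−iτ}(y) − K_{α−iτ}(y) I_{α+iτ}(y)] dy/y = i/(2ατ) + (ix/(2ατ)) · d/dx[ K_{α+iτ}(√x) I_{α−iτ}(√x) + K_{α−iτ}(√x) I_{α+iτ}(√x) ] − (i√x/(2ατ)) · [ K_{α+iτ}(√x) I′_{α−iτ}(√x) + K_{α−iτ}(√x) I′_{α+iτ}(√x) ], where I′ denotes the derivative of I_ν with respect to its argument. -/

import Mathlib

/-- Modified Bessel function of the second kind (Macdonald function). -/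
noncomputable def besselK (ν : ℂ) (x : ℝ) : ℂ :=
  ∫ t in Set.Ioi (0 : ℝ), Complex.exp (-(x : ℂ) * Real.cosh t) * Complex.cosh (ν * t)

/-- Modified Bessel function of the first kind. -/
noncomputable def besselI (ν : ℂ) (x : ℝ) : ℂ :=
  ∑' k : ℕ, ((x : ℂ) / 2) ^ (ν + 2 * (k : ℂ)) / ((Nat.factorial k : ℂ) * Complex.Gamma (ν + (k : ℂ) + 1))

section

open Complex Set Filter Topology MeasureTheory

/-- The entire function `z ↦ ∑ z ^ k / (k! Γ(ν + k + 1))`, a regularized `₀F₁`. -/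
noncomputable def besselSeries (ν z : ℂ) : ℂ :=
  ∑' k : ℕ, z ^ k / ((Nat.factorial k : ℂ) * Complex.Gamma (ν + (k : ℂ) + 1))

theorem Gamma_add_nat_add_one_ne_zero {ν : ℂ} (hν : 0 ≤ ν.re) (k : ℕ) :
    Complex.Gamma (ν + k + 1) ≠ 0 := by
  apply Complex.Gamma_ne_zero_of_re_pos
  simp
  positivity

theorem Gamma_add_nat_succ_add_one {ν : ℂ} (hν : 0 ≤ ν.re) (k : ℕ) :
    Complex.Gamma (ν + (k + 1 : ℕ) + 1) = (ν + k + 1) * Complex.Gamma (ν + k + 1) := by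
  have h : ν + k + 1 ≠ 0 := by
    intro h
    have := congrArg Complex.re h
    simp at this
    linarith [(Nat.cast_nonneg k : (0 : ℝ) ≤ k)]
  rw [← Complex.Gamma_add_one _ h]
  push_cast
  ring_nf

theorem norm_Gamma_add_one_le {ν : ℂ} (hν : 0 ≤ ν.re) (k : ℕ) :
    ‖Complex.Gamma (ν + 1)‖ ≤ ‖Complex.Gamma (ν + k + 1)‖ := by
  induction k with
  | zero => simp
  | succ k ih =>
    rw [Gamma_add_nat_succ_add_one hν, norm_mul]
    have h1 : 1 ≤ ‖ν + k + 1‖ := by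
      refine le_trans ?_ (Complex.re_le_norm _)
      simp
      positivity
    nlinarith [norm_nonneg (Complex.Gamma (ν + k + 1))]

theorem norm_besselSeries_term_le {ν : ℂ} (hν : 0 ≤ ν.re) {z : ℂ} {R : ℝ} (hz : ‖z‖ ≤ R)
    (k : ℕ) :
    ‖z ^ k / ((Nat.factorial k : ℂ) * Complex.Gamma (ν + (k : ℂ) + 1))‖
      ≤ R ^ k / (Nat.factorial k : ℝ) * ‖Complex.Gamma (ν + 1)‖⁻¹ := by
  have h0 : 0 < ‖Complex.Gamma (ν + 1)‖ := by
    simpa using Gamma_add_nat_add_one_ne_zero hν 0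
  rw [norm_div, norm_mul, norm_pow, ← div_eq_mul_inv, div_div]
  have : ‖(Nat.factorial k : ℂ)‖ = Nat.factorial k := by simp
  rw [this]
  have h1 := norm_Gamma_add_one_le hν k
  have h2 : 0 ≤ R := (norm_nonneg z).trans hz
  have : (0 : ℝ) < Nat.factorial k := by positivity
  gcongr

theorem summable_besselSeries {ν : ℂ} (hν : 0 ≤ ν.re) (z : ℂ) :
    Summable fun k : ℕ => z ^ k / ((Nat.factorial k : ℂ) * Complex.Gamma (ν + (k : ℂ) + 1)) :=
  .of_norm_bounded ((Real.summable_pow_div_factorial ‖z‖).mul_right _)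
    (norm_besselSeries_term_le hν le_rfl)

theorem hasDerivAt_besselSeries {ν : ℂ} (hν : 0 ≤ ν.re) (z : ℂ) :
    HasDerivAt (besselSeries ν) (besselSeries (ν + 1) z) z := by
  have hu := (Real.summable_pow_div_factorial (‖z‖ + 1)).mul_right ‖Complex.Gamma (ν + 1)‖⁻¹
  have hd : ∀ k : ℕ, DifferentiableOn ℂ
      (fun z : ℂ => z ^ k / ((Nat.factorial k : ℂ) * Complex.Gamma (ν + (k : ℂ) + 1)))
      (Metric.ball 0 (‖z‖ + 1)) := fun k => by fun_prop
  have hz : z ∈ Metric.ball (0 : ℂ) (‖z‖ + 1) := by simp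
  have hb : ∀ (k : ℕ) (w : ℂ), w ∈ Metric.ball (0 : ℂ) (‖z‖ + 1) →
      ‖w ^ k / ((Nat.factorial k : ℂ) * Complex.Gamma (ν + (k : ℂ) + 1))‖ ≤
        (‖z‖ + 1) ^ k / (Nat.factorial k : ℝ) * ‖Complex.Gamma (ν + 1)‖⁻¹ := fun k w hw =>
    norm_besselSeries_term_le hν (mem_ball_zero_iff.1 hw).le k
  have h1 : HasSum _ (deriv (besselSeries ν) z) :=
    Complex.hasSum_deriv_of_summable_norm hu hd Metric.isOpen_ball hb hz
  have h2 := (Complex.differentiableOn_tsum_of_summable_norm hu hd Metric.isOpen_ball hb).differentiableAt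
    (Metric.isOpen_ball.mem_nhds hz)
  have h3 : besselSeries (ν + 1) z = deriv (besselSeries ν) z := by
    refine HasSum.unique (summable_besselSeries (by simp; linarith) z).hasSum ?_
    rw [← hasSum_nat_add_iff' 1] at h1
    have e1 : (fun k : ℕ => z ^ k / ((Nat.factorial k : ℂ) * Complex.Gamma (ν + 1 + (k : ℂ) + 1))) =
        fun k : ℕ => deriv (fun w : ℂ => w ^ (k + 1) /
          ((Nat.factorial (k + 1) : ℂ) * Complex.Gamma (ν + ((k + 1 : ℕ) : ℂ) + 1))) z := by
      funext k
      rw [deriv_div_const, deriv_pow_field, Nat.add_sub_cancel]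
      have e : ν + 1 + k + 1 = ν + (k + 1 : ℕ) + 1 := by push_cast; ring
      rw [e, Nat.factorial_succ]
      have := Gamma_add_nat_add_one_ne_zero hν (k + 1)
      have hk : ((k + 1 : ℕ) : ℂ) ≠ 0 := by exact_mod_cast Nat.succ_ne_zero k
      have hf : (Nat.factorial k : ℂ) ≠ 0 := by exact_mod_cast Nat.factorial_ne_zero k
      rw [Nat.cast_mul]
      field_simp
    rw [e1]
    simpa using h1
  rw [h3]
  exact h2.hasDerivAt

theorem besselSeries_recurrence {ν : ℂ} (hν : 0 ≤ ν.re) (z : ℂ) :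
    besselSeries ν z = (ν + 1) * besselSeries (ν + 1) z + z * besselSeries (ν + 2) z := by
  have hν1 : 0 ≤ (ν + 1).re := by simp; linarith
  have hν2 : 0 ≤ (ν + 2).re := by simp; linarith
  have s0 := summable_besselSeries hν z
  have s1 := summable_besselSeries hν1 z
  have s2 := summable_besselSeries hν2 z
  unfold besselSeries
  rw [s0.tsum_eq_zero_add, s1.tsum_eq_zero_add, mul_add (ν + 1), ← tsum_mul_left, ← tsum_mul_left,
    add_assoc ((ν + 1) * _), ← Summable.tsum_add (((summable_nat_add_iff 1).2 s1).mul_left _) (s2.mul_left _)]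
  have hg : ∀ k : ℕ, ν + k + 1 ≠ 0 := fun k h => by
    have := congrArg Complex.re h
    simp at this
    linarith [(Nat.cast_nonneg k : (0 : ℝ) ≤ k)]
  congr 1
  · have h := Gamma_add_nat_succ_add_one hν 0
    have h0 := Gamma_add_nat_add_one_ne_zero hν 0
    have := hg 0
    simp at h h0 this ⊢
    rw [h]
    field_simp
  · congr 1
    ext k
    have h := Gamma_add_nat_succ_add_one hν (k + 1)
    have h0 := Gamma_add_nat_add_one_ne_zero hν (k + 1)
    have h1 := hg (k + 1)
    have e1 : ν + 1 + (k + 1 : ℕ) + 1 = ν + (k + 1 + 1 : ℕ) + 1 := by push_cast; ring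
    have e2 : ν + 2 + k + 1 = ν + (k + 1 + 1 : ℕ) + 1 := by push_cast; ring
    rw [e1, e2, h, Nat.factorial_succ]
    have hf : (Nat.factorial k : ℂ) ≠ 0 := by exact_mod_cast Nat.factorial_ne_zero k
    have hk : ((k : ℂ) + 1) ≠ 0 := by exact_mod_cast Nat.succ_ne_zero k
    push_cast at h0 h1 ⊢
    field_simp
    ring

theorem besselI_eq (ν : ℂ) {x : ℝ} (hx : 0 < x) :
    besselI ν x = ((x : ℂ) / 2) ^ ν * besselSeries ν (((x : ℂ) / 2) ^ 2) := by
  have h : (x : ℂ) / 2 ≠ 0 := by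
    have : (x : ℂ) ≠ 0 := by exact_mod_cast hx.ne'
    simpa
  rw [besselI, besselSeries, ← tsum_mul_left]
  congr 1
  ext k
  rw [Complex.cpow_add _ _ h, ← pow_mul]
  have : (2 * (k : ℂ)) = ((2 * k : ℕ) : ℂ) := by push_cast; ring
  rw [this, Complex.cpow_natCast, mul_div_assoc]

theorem besselI_recurrence {ν : ℂ} (hν : 0 ≤ ν.re) {x : ℝ} (hx : 0 < x) :
    besselI ν x = besselI (ν + 2) x + 2 * (ν + 1) / x * besselI (ν + 1) x := by
  have h0 : (x : ℂ) ≠ 0 := by exact_mod_cast hx.ne'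
  have h : (x : ℂ) / 2 ≠ 0 := div_ne_zero h0 two_ne_zero
  have h2 : ((x : ℂ) / 2) ^ (2 : ℂ) = (x / 2) ^ 2 := by
    rw [← Complex.cpow_natCast]; norm_num
  rw [besselI_eq _ hx, besselI_eq _ hx, besselI_eq _ hx, besselSeries_recurrence hν,
    Complex.cpow_add _ _ h, Complex.cpow_add _ _ h, h2, Complex.cpow_one]
  field_simp
  ring

theorem hasDerivAt_besselI {ν : ℂ} (hν : 0 ≤ ν.re) {x : ℝ} (hx : 0 < x) :
    HasDerivAt (besselI ν) (besselI (ν + 1) x + ν / x * besselI ν x) x := by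
  have h0 : (x : ℂ) ≠ 0 := by exact_mod_cast hx.ne'
  have h : (x : ℂ) / 2 ≠ 0 := div_ne_zero h0 two_ne_zero
  have hs : (x : ℂ) / 2 ∈ Complex.slitPlane := by
    left
    simpa
  have hid : HasDerivAt (fun z : ℂ => z / 2) (1 / 2) x := (hasDerivAt_id _).div_const 2
  have h1 : HasDerivAt (fun z : ℂ => (z / 2) ^ ν) _ (x : ℂ) := hid.cpow_const hs
  have h2 := (hasDerivAt_besselSeries hν (((x : ℂ) / 2) ^ 2)).comp_of_eq (x : ℂ)
    (hid.fun_pow 2) rfl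
  have h3 := (h1.mul h2).comp_ofReal
  refine (h3.congr_of_eventuallyEq ?_).congr_deriv ?_
  · filter_upwards [lt_mem_nhds hx] with y hy
    simp [besselI_eq ν hy]
  · rw [besselI_eq _ hx, besselI_eq _ hx, Complex.cpow_add _ _ h, Complex.cpow_sub _ _ h,
      Complex.cpow_one]
    simp only [Function.comp_apply]
    field_simp
    ring

theorem hasDerivAt_besselI_add_one {ν : ℂ} (hν : 0 ≤ ν.re) {x : ℝ} (hx : 0 < x) :
    HasDerivAt (besselI (ν + 1)) (besselI ν x - (ν + 1) / x * besselI (ν + 1) x) x := by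
  have hν1 : 0 ≤ (ν + 1).re := by simp; linarith
  refine (hasDerivAt_besselI hν1 hx).congr_deriv ?_
  rw [besselI_recurrence hν hx, add_assoc, one_add_one_eq_two]
  ring

theorem one_add_sq_div_two_le_cosh {t : ℝ} (ht : 0 ≤ t) : 1 + t ^ 2 / 2 ≤ Real.cosh t := by
  have h1 : t / 2 ≤ Real.sinh (t / 2) := Real.self_le_sinh_iff.2 (by positivity)
  have h2 : Real.cosh t = 1 + 2 * Real.sinh (t / 2) ^ 2 := by
    have := Real.cosh_two_mul (t / 2)
    rw [Real.cosh_sq, show 2 * (t / 2) = t by ring] at this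
    linarith
  nlinarith

theorem norm_cosh_le (z : ℂ) : ‖Complex.cosh z‖ ≤ Real.exp ‖z‖ := by
  rw [Complex.cosh, norm_div, Complex.norm_two, div_le_iff₀ two_pos]
  have h1 := norm_exp_le_exp_norm z
  have h2 := norm_exp_le_exp_norm (-z)
  rw [norm_neg] at h2
  linarith [norm_add_le (Complex.exp z) (Complex.exp (-z))]

theorem norm_sinh_le (z : ℂ) : ‖Complex.sinh z‖ ≤ Real.exp ‖z‖ := by
  rw [Complex.sinh, norm_div, Complex.norm_two, div_le_iff₀ two_pos]
  have h1 := norm_exp_le_exp_norm z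
  have h2 := norm_exp_le_exp_norm (-z)
  rw [norm_neg] at h2
  linarith [norm_sub_le (Complex.exp z) (Complex.exp (-z))]

theorem norm_exp_neg_mul_cosh_le {y t : ℝ} (hy : 0 ≤ y) (ht : 0 ≤ t) :
    ‖Complex.exp (-(y : ℂ) * Real.cosh t)‖ ≤ Real.exp (-y) * Real.exp (-(y / 2) * t ^ 2) := by
  rw [Complex.norm_exp, ← Real.exp_add]
  have h : (-(y : ℂ) * Real.cosh t).re = -(y * Real.cosh t) := by
    rw [← Complex.ofReal_neg, ← Complex.ofReal_mul, Complex.ofReal_re, neg_mul]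
  rw [h, Real.exp_le_exp]
  nlinarith [one_add_sq_div_two_le_cosh ht]

/-- The integrand of the Macdonald function. -/
noncomputable def besselKernel (μ : ℂ) (y t : ℝ) : ℂ :=
  Complex.exp (-(y : ℂ) * Real.cosh t) * Complex.cosh (μ * t)

theorem norm_besselKernel_le (μ : ℂ) {y t : ℝ} (hy : 0 ≤ y) (ht : 0 ≤ t) :
    ‖besselKernel μ y t‖ ≤ Real.exp (-y) * Real.exp (-(y / 2) * t ^ 2 + ‖μ‖ * t) := by
  have h := norm_cosh_le (μ * t)
  rw [norm_mul, Complex.norm_real, Real.norm_of_nonneg ht] at h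
  rw [besselKernel, norm_mul, Real.exp_add, ← mul_assoc]
  exact mul_le_mul (norm_exp_neg_mul_cosh_le hy ht) h (norm_nonneg _) (by positivity)

theorem integrable_exp_neg_mul_sq_add_mul {b : ℝ} (hb : 0 < b) (c : ℝ) :
    Integrable fun t : ℝ => Real.exp (-b * t ^ 2 + c * t) := by
  have h := (integrable_cexp_quadratic (b := (b : ℂ)) (by simpa) c 0).norm
  refine h.congr (.of_forall fun t => ?_)
  simp only [Complex.norm_exp]
  congr 1
  norm_cast
  simp

theorem continuous_besselKernel (μ : ℂ) (y : ℝ) : Continuous (besselKernel μ y) := by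
  unfold besselKernel
  fun_prop

theorem integrableOn_besselKernel (μ : ℂ) {y : ℝ} (hy : 0 < y) :
    IntegrableOn (besselKernel μ y) (Ioi 0) := by
  refine Integrable.mono' (((integrable_exp_neg_mul_sq_add_mul (half_pos hy) ‖μ‖).const_mul
    (Real.exp (-y))).integrableOn) (continuous_besselKernel μ y).aestronglyMeasurable ?_
  filter_upwards [ae_restrict_mem measurableSet_Ioi] with t ht
  exact norm_besselKernel_le μ hy.le (le_of_lt ht)

theorem cosh_mul_besselKernel (μ : ℂ) (y t : ℝ) :
    Real.cosh t * besselKernel μ y t =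
      (besselKernel (μ + 1) y t + besselKernel (μ - 1) y t) / 2 := by
  simp only [besselKernel, add_mul, sub_mul, one_mul, Complex.cosh_add, Complex.cosh_sub,
    Complex.ofReal_cosh]
  ring

theorem hasDerivAt_besselK_aux (μ : ℂ) {y : ℝ} (hy : 0 < y) :
    HasDerivAt (besselK μ) (-(besselK (μ + 1) y + besselK (μ - 1) y) / 2) y := by
  have key := (hasDerivAt_integral_of_dominated_loc_of_deriv_le (𝕜 := ℝ)
    (μ := volume.restrict (Ioi (0 : ℝ))) (F := besselKernel μ)
    (F' := fun y t => -(besselKernel (μ + 1) y t + besselKernel (μ - 1) y t) / 2)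
    (bound := fun t => (Real.exp (-(y / 4) * t ^ 2 + ‖μ + 1‖ * t) +
      Real.exp (-(y / 4) * t ^ 2 + ‖μ - 1‖ * t)) / 2)
    (Ioi_mem_nhds (half_lt_self hy)) (.of_forall fun z =>
      (continuous_besselKernel μ z).aestronglyMeasurable) (integrableOn_besselKernel μ hy)
    (by
      have := continuous_besselKernel (μ + 1) y
      have := continuous_besselKernel (μ - 1) y
      exact Continuous.aestronglyMeasurable (by fun_prop)) ?_ ?_ ?_).2
  · refine key.congr_deriv ?_
    rw [integral_div, integral_neg, integral_add (integrableOn_besselKernel _ hy)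
      (integrableOn_besselKernel _ hy)]
    rfl
  · filter_upwards [ae_restrict_mem measurableSet_Ioi] with t ht z hz
    have hz' : y / 2 < z := hz
    have hz0 : 0 < z := (half_pos hy).trans hz'
    have hb : ∀ ν : ℂ, ‖besselKernel ν z t‖ ≤ Real.exp (-(y / 4) * t ^ 2 + ‖ν‖ * t) := by
      intro ν
      refine (norm_besselKernel_le ν hz0.le (le_of_lt ht)).trans ?_
      rw [← Real.exp_add, Real.exp_le_exp]
      nlinarith [sq_nonneg t]
    rw [norm_div, norm_neg, Complex.norm_two]
    linarith [norm_add_le (besselKernel (μ + 1) z t) (besselKernel (μ - 1) z t), hb (μ + 1),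
      hb (μ - 1)]
  · exact (((integrable_exp_neg_mul_sq_add_mul (by positivity) _).add
      (integrable_exp_neg_mul_sq_add_mul (by positivity) _)).div_const 2).integrableOn
  · refine .of_forall fun t z _ => ?_
    have h1 : HasDerivAt (fun w : ℂ => Complex.exp (-w * Real.cosh t) * Complex.cosh (μ * t)) _
      (z : ℂ) := (((hasDerivAt_id (z : ℂ)).neg.mul_const _).cexp).mul_const _
    refine h1.comp_ofReal.congr_deriv ?_
    rw [neg_div, ← cosh_mul_besselKernel, besselKernel]
    simp only [Pi.neg_apply, id]
    ring

theorem besselK_recurrence (μ : ℂ) {y : ℝ} (hy : 0 < y) :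
    y * (besselK (μ + 1) y - besselK (μ - 1) y) = 2 * μ * besselK μ y := by
  have hi : ∀ ν, IntegrableOn (besselKernel ν y) (Ioi 0) := fun ν => integrableOn_besselKernel ν hy
  have hi1 := (hi μ).const_mul μ
  have hi2 : IntegrableOn (fun t => (y : ℂ) / 2 *
      (besselKernel (μ + 1) y t - besselKernel (μ - 1) y t)) (Ioi 0) :=
    ((hi _).sub (hi _)).const_mul _
  have h := integral_Ioi_of_hasDerivAt_of_tendsto (a := 0) (m := (0 : ℂ))
    (f := fun t : ℝ => Complex.exp (-(y : ℂ) * Real.cosh t) * Complex.sinh (μ * t))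
    (f' := fun t => μ * besselKernel μ y t -
      y / 2 * (besselKernel (μ + 1) y t - besselKernel (μ - 1) y t))
    (by fun_prop) (fun t _ => ?_)
    (hi1.sub hi2) ?_
  · rw [integral_sub hi1 hi2, integral_const_mul, integral_const_mul,
      integral_sub (hi _) (hi _)] at h
    change μ * besselK μ y - y / 2 * (besselK (μ + 1) y - besselK (μ - 1) y) = _ at h
    simp at h
    linear_combination -2 * h
  · have h1 : HasDerivAt (fun w : ℂ => Complex.exp (-(y : ℂ) * Complex.cosh w) *
        Complex.sinh (μ * w)) _ (t : ℂ) :=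
      (((Complex.hasDerivAt_cosh (t : ℂ)).const_mul (-(y : ℂ))).cexp).mul
        (((hasDerivAt_id (t : ℂ)).const_mul μ).csinh)
    have h2 := h1.comp_ofReal
    simp only [← Complex.ofReal_cosh] at h2
    refine h2.congr_deriv ?_
    simp only [besselKernel, add_mul, sub_mul, one_mul, Complex.cosh_add, Complex.cosh_sub,
      Complex.ofReal_cosh, id]
    ring
  · have h1 : Tendsto (fun t : ℝ => t * (-(y / 2) * t + ‖μ‖)) atTop atBot :=
      tendsto_id.atTop_mul_atBot₀ (tendsto_atBot_add_const_right _ _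
        (tendsto_id.const_mul_atTop_of_neg (by linarith)))
    refine squeeze_zero_norm' ?_ (Real.tendsto_exp_atBot.comp h1)
    filter_upwards [eventually_ge_atTop 0] with t ht
    have h := norm_sinh_le (μ * t)
    rw [norm_mul, Complex.norm_real, Real.norm_of_nonneg ht] at h
    rw [norm_mul, Function.comp_apply, show t * (-(y / 2) * t + ‖μ‖) = -(y / 2) * t ^ 2 + ‖μ‖ * t by
      ring, Real.exp_add]
    refine mul_le_mul ((norm_exp_neg_mul_cosh_le hy.le ht).trans ?_) h (norm_nonneg _)
      (by positivity)
    exact mul_le_of_le_one_left (by positivity) (Real.exp_le_one_iff.2 (by linarith))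

theorem hasDerivAt_besselK (μ : ℂ) {y : ℝ} (hy : 0 < y) :
    HasDerivAt (besselK μ) (μ / y * besselK μ y - besselK (μ + 1) y) y := by
  have h0 : (y : ℂ) ≠ 0 := by exact_mod_cast hy.ne'
  refine (hasDerivAt_besselK_aux μ hy).congr_deriv ?_
  field_simp
  linear_combination besselK_recurrence μ hy

theorem hasDerivAt_besselK_add_one (μ : ℂ) {y : ℝ} (hy : 0 < y) :
    HasDerivAt (besselK (μ + 1)) (-((μ + 1) / y * besselK (μ + 1) y) - besselK μ y) y := by
  have h0 : (y : ℂ) ≠ 0 := by exact_mod_cast hy.ne'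
  have h := besselK_recurrence (μ + 1) hy
  rw [add_sub_cancel_right] at h
  refine (hasDerivAt_besselK (μ + 1) hy).congr_deriv ?_
  field_simp
  linear_combination -h

theorem tendsto_mul_cosh_div_sqrt_sub_one (s : ℝ) :
    Tendsto (fun y : ℝ => y * (Real.cosh ((√y)⁻¹ * s) - 1)) atTop (𝓝 (s ^ 2 / 2)) := by
  have h1 : HasDerivAt (fun h : ℝ => Real.sinh (h * (s / 2))) (s / 2) 0 := by
    simpa using ((hasDerivAt_id (0 : ℝ)).mul_const (s / 2)).sinh
  have h2 : Tendsto (fun y : ℝ => (√y)⁻¹) atTop (𝓝[≠] 0) :=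
    ((tendsto_inv_atTop_nhdsGT_zero.comp Real.tendsto_sqrt_atTop)).mono_right
      (nhdsWithin_mono _ fun _ h => ne_of_gt h)
  have h3 := ((h1.tendsto_slope_zero.comp h2).pow 2).const_mul 2
  rw [show s ^ 2 / 2 = 2 * (s / 2) ^ 2 by ring]
  refine h3.congr' ?_
  filter_upwards [eventually_gt_atTop 0] with y hy
  have h4 := Real.cosh_two_mul ((√y)⁻¹ * (s / 2))
  rw [Real.cosh_sq, show 2 * ((√y)⁻¹ * (s / 2)) = (√y)⁻¹ * s by ring] at h4
  simp [h4, mul_pow, Real.sq_sqrt hy.le]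
  ring

theorem tendsto_sqrt_mul_exp_mul_besselK (μ : ℂ) :
    Tendsto (fun y : ℝ => (√y : ℂ) * Complex.exp y * besselK μ y) atTop
      (𝓝 (√(Real.pi / 2) : ℂ)) := by
  have hlim : (∫ s in Ioi (0 : ℝ), ((Real.exp (-(1 / 2) * s ^ 2) : ℝ) : ℂ)) = √(Real.pi / 2) := by
    rw [integral_complex_ofReal, integral_gaussian_Ioi]
    congr 1
    rw [show Real.pi / (1 / 2) = 2 ^ 2 * (Real.pi / 2) by ring, Real.sqrt_mul (by positivity),
      Real.sqrt_sq (by positivity)]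
    ring
  rw [← hlim]
  have key : Tendsto (fun y : ℝ => ∫ s in Ioi (0 : ℝ),
      Complex.exp y * besselKernel μ y ((√y)⁻¹ * s)) atTop
      (𝓝 (∫ s in Ioi (0 : ℝ), ((Real.exp (-(1 / 2) * s ^ 2) : ℝ) : ℂ))) := by
    refine tendsto_integral_filter_of_dominated_convergence
      (fun s => Real.exp (-(1 / 2) * s ^ 2 + ‖μ‖ * s)) ?_ ?_
      (integrable_exp_neg_mul_sq_add_mul (by norm_num) _).integrableOn ?_
    · refine .of_forall fun y => Continuous.aestronglyMeasurable ?_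
      have := continuous_besselKernel μ y
      fun_prop
    · filter_upwards [eventually_ge_atTop 1] with y hy
      filter_upwards [ae_restrict_mem measurableSet_Ioi] with s hs
      have hs' : 0 < s := hs
      have hy0 : 0 < y := by linarith
      rw [norm_mul, Complex.norm_exp, Complex.ofReal_re]
      calc _ ≤ Real.exp y * (Real.exp (-y) * Real.exp (-(y / 2) * ((√y)⁻¹ * s) ^ 2 +
              ‖μ‖ * ((√y)⁻¹ * s))) := by
            gcongr
            exact norm_besselKernel_le μ hy0.le (by positivity)
        _ ≤ _ := by
            rw [← mul_assoc, ← Real.exp_add, add_neg_cancel, Real.exp_zero, one_mul,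
              Real.exp_le_exp, mul_pow, inv_pow, Real.sq_sqrt hy0.le]
            have h1 : (√y)⁻¹ ≤ 1 := inv_le_one_of_one_le₀ (Real.one_le_sqrt.2 hy)
            have h2 : (√y)⁻¹ * s ≤ s := mul_le_of_le_one_left hs'.le h1
            have h3 : -(y / 2) * (y⁻¹ * s ^ 2) = -(1 / 2) * s ^ 2 := by field_simp
            rw [h3]
            gcongr
    · refine .of_forall fun s => ?_
      have h1 := (tendsto_mul_cosh_div_sqrt_sub_one s).neg
      have h2 : Tendsto (fun y : ℝ => Complex.cosh (μ * (((√y)⁻¹ * s : ℝ) : ℂ))) atTop (𝓝 1) := by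
        have h3 : Tendsto (fun y : ℝ => (√y)⁻¹) atTop (𝓝 0) :=
          tendsto_inv_atTop_zero.comp Real.tendsto_sqrt_atTop
        have h4 : Continuous fun h : ℝ => Complex.cosh (μ * ((h * s : ℝ) : ℂ)) := by fun_prop
        simpa [Function.comp_def] using (h4.tendsto 0).comp h3
      have h5 := (((Complex.continuous_ofReal.comp Real.continuous_exp).tendsto _).comp h1).mul h2
      rw [mul_one, show -(s ^ 2 / 2) = -(1 / 2) * s ^ 2 by ring] at h5
      refine h5.congr fun y => ?_
      simp only [Function.comp_apply, besselKernel, ← mul_assoc, ← Complex.exp_add]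
      rw [Complex.ofReal_exp]
      congr 2
      push_cast
      ring
  refine key.congr' ?_
  filter_upwards [eventually_gt_atTop 0] with y hy
  rw [integral_const_mul, integral_comp_mul_left_Ioi (besselKernel μ y) 0
    (inv_pos.2 (Real.sqrt_pos.2 hy)), mul_zero, inv_inv, Complex.real_smul, besselK]
  simp only [besselKernel]
  ring

theorem Gamma_nat_add_half_eq (k : ℕ) :
    Complex.Gamma (k + 1 / 2) =
      ((2 * k).factorial : ℂ) / (4 ^ k * (k.factorial : ℂ)) * (√Real.pi : ℂ) := by
  induction k with
  | zero =>
    rw [Nat.cast_zero, zero_add, Complex.Gamma_one_half_eq, Real.sqrt_eq_rpow,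
      Complex.ofReal_cpow Real.pi_pos.le]
    simp
  | succ k ih =>
    have h : (k : ℂ) + 1 / 2 ≠ 0 := by
      intro h
      have := congrArg Complex.re h
      norm_num at this
      linarith [(Nat.cast_nonneg k : (0 : ℝ) ≤ k)]
    have hf : (Nat.factorial k : ℂ) ≠ 0 := by exact_mod_cast Nat.factorial_ne_zero k
    have hk : ((k : ℂ) + 1) ≠ 0 := by exact_mod_cast Nat.succ_ne_zero k
    rw [show ((k + 1 : ℕ) : ℂ) + 1 / 2 = (k + 1 / 2) + 1 by push_cast; ring,
      Complex.Gamma_add_one _ h, ih, show 2 * (k + 1) = 2 * k + 1 + 1 by ring,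
      Nat.factorial_succ, Nat.factorial_succ, Nat.factorial_succ]
    push_cast
    field_simp
    ring

theorem integral_pow_mul_one_sub_sq_cpow {ν : ℂ} (hν : 1 / 2 < ν.re) (k : ℕ) :
    2 * ∫ t in Ioo (0 : ℝ) 1, (t : ℂ) ^ (2 * k) * ((1 - t ^ 2 : ℝ) : ℂ) ^ (ν - 1 / 2) =
      Complex.Gamma (k + 1 / 2) * Complex.Gamma (ν + 1 / 2) / Complex.Gamma (ν + k + 1) := by
  have h1 := Complex.Gamma_mul_Gamma_eq_betaIntegral (s := k + 1 / 2) (t := ν + 1 / 2)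
    (by norm_num; positivity) (by norm_num; linarith)
  rw [show (k : ℂ) + 1 / 2 + (ν + 1 / 2) = ν + k + 1 by ring] at h1
  rw [h1, mul_div_cancel_left₀ _ (Gamma_add_nat_add_one_ne_zero (by linarith) k),
    Complex.betaIntegral, intervalIntegral.integral_of_le zero_le_one,
    integral_Ioc_eq_integral_Ioo]
  have himg : (fun t : ℝ => t ^ 2) '' Ioo 0 1 = Ioo 0 1 := by
    ext v
    constructor
    · rintro ⟨t, ⟨h0, h1⟩, rfl⟩
      exact ⟨by positivity, by simp only; nlinarith⟩
    · rintro ⟨h0, h1⟩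
      refine ⟨√v, ⟨Real.sqrt_pos.2 h0, ?_⟩, Real.sq_sqrt h0.le⟩
      rw [Real.sqrt_lt' one_pos]
      simpa
  conv_rhs => rw [← himg]
  rw [integral_image_eq_integral_abs_deriv_smul (f' := fun t => 2 * t) measurableSet_Ioo
    (fun t _ => by simpa using (hasDerivAt_pow 2 t).hasDerivWithinAt)
    (fun a ha b hb hab => (pow_left_inj₀ ha.1.le hb.1.le two_ne_zero).1 hab), ← integral_const_mul]
  refine setIntegral_congr_fun measurableSet_Ioo fun t ht => ?_
  have ht0 : (t : ℂ) ≠ 0 := by exact_mod_cast ht.1.ne'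
  have hs : ((t : ℂ) ^ 2) ^ (2⁻¹ : ℂ) = t := Complex.sq_cpow_two_inv (by simpa using ht.1)
  rw [abs_of_pos (by linarith [ht.1]), Complex.real_smul,
    show (k : ℂ) + 1 / 2 - 1 = k - 2⁻¹ by ring, show ν + 1 / 2 - 1 = ν - 1 / 2 by ring]
  push_cast
  rw [Complex.cpow_sub _ _ (pow_ne_zero 2 ht0), hs, Complex.cpow_natCast, ← pow_mul]
  field_simp

theorem norm_one_sub_sq_cpow_le {a : ℂ} (ha : 0 < a.re) {t : ℝ} (ht : t ∈ Ioo (0 : ℝ) 1) :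
    ‖((1 - t ^ 2 : ℝ) : ℂ) ^ a‖ ≤ 1 := by
  have h : 0 < 1 - t ^ 2 := by nlinarith [ht.1, ht.2]
  rw [Complex.norm_cpow_eq_rpow_re_of_pos h]
  exact Real.rpow_le_one h.le (by nlinarith [ht.1]) ha.le

/-- Poisson's integral for the modified Bessel function of the first kind. -/
theorem two_mul_integral_cosh_mul_one_sub_sq_cpow {ν : ℂ} (hν : 1 / 2 < ν.re) (x : ℝ) :
    2 * ∫ t in Ioo (0 : ℝ) 1, Complex.cosh (x * t) * ((1 - t ^ 2 : ℝ) : ℂ) ^ (ν - 1 / 2) =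
      (√Real.pi : ℂ) * Complex.Gamma (ν + 1 / 2) * besselSeries ν (((x : ℂ) / 2) ^ 2) := by
  have ha : 0 < (ν - 1 / 2).re := by norm_num; linarith
  have h := (hasSum_integral_of_dominated_convergence (μ := volume.restrict (Ioo (0 : ℝ) 1))
    (F := fun (k : ℕ) (t : ℝ) => ((x : ℂ) * t) ^ (2 * k) / ((2 * k).factorial : ℂ) *
      ((1 - t ^ 2 : ℝ) : ℂ) ^ (ν - 1 / 2))
    (f := fun t => Complex.cosh (x * t) * ((1 - t ^ 2 : ℝ) : ℂ) ^ (ν - 1 / 2))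
    (fun k _ => |x| ^ (2 * k) / ((2 * k).factorial : ℝ))
    (fun k => Measurable.aestronglyMeasurable (by fun_prop)) ?_
    (.of_forall fun _ => (Real.hasSum_cosh |x|).summable) (integrable_const _)
    (.of_forall fun t => (Complex.hasSum_cosh (x * t)).mul_right _)).mul_left 2
  · refine h.unique ?_
    have h0 := (summable_besselSeries (ν := ν) (by linarith) (((x : ℂ) / 2) ^ 2)).hasSum.mul_left
      ((√Real.pi : ℂ) * Complex.Gamma (ν + 1 / 2))
    refine h0.congr_fun ?_
    intro k
    have e : ∀ t : ℝ, ((x : ℂ) * t) ^ (2 * k) / ((2 * k).factorial : ℂ) *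
        ((1 - t ^ 2 : ℝ) : ℂ) ^ (ν - 1 / 2) = (x : ℂ) ^ (2 * k) / ((2 * k).factorial : ℂ) *
        ((t : ℂ) ^ (2 * k) * ((1 - t ^ 2 : ℝ) : ℂ) ^ (ν - 1 / 2)) := fun t => by
      rw [mul_pow]; ring
    simp only [e]
    rw [integral_const_mul, mul_left_comm, integral_pow_mul_one_sub_sq_cpow hν,
      Gamma_nat_add_half_eq]
    have hf : (Nat.factorial k : ℂ) ≠ 0 := by exact_mod_cast Nat.factorial_ne_zero k
    have hf2 : (Nat.factorial (2 * k) : ℂ) ≠ 0 := by exact_mod_cast Nat.factorial_ne_zero (2 * k)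
    have hg := Gamma_add_nat_add_one_ne_zero (ν := ν) (by linarith) k
    rw [← pow_mul, div_pow, pow_mul 2 2 k, show (2 : ℂ) ^ 2 = 4 by norm_num]
    field_simp
  · intro k
    filter_upwards [ae_restrict_mem measurableSet_Ioo] with t ht
    rw [norm_mul, norm_div, norm_pow, norm_mul, Complex.norm_real, Complex.norm_real,
      Complex.norm_natCast]
    refine (mul_le_of_le_one_right (by positivity) (norm_one_sub_sq_cpow_le ha ht)).trans ?_
    have : ‖x‖ * ‖t‖ ≤ |x| := by
      rw [Real.norm_eq_abs, Real.norm_of_nonneg ht.1.le]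
      exact mul_le_of_le_one_right (abs_nonneg _) ht.2.le
    gcongr

theorem tendsto_two_mul_exp_neg_mul_cosh_sub (s : ℝ) :
    Tendsto (fun y : ℝ => 2 * Real.exp (-y) * Real.cosh (y - s)) atTop (𝓝 (Real.exp (-s))) := by
  have h : Tendsto (fun y : ℝ => Real.exp (-s) + Real.exp (s + -(2 * y))) atTop
      (𝓝 (Real.exp (-s) + 0)) :=
    tendsto_const_nhds.add (Real.tendsto_exp_atBot.comp (tendsto_atBot_add_const_left _ _
      (tendsto_neg_atTop_atBot.comp (tendsto_id.const_mul_atTop two_pos))))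
  rw [add_zero] at h
  refine h.congr fun y => ?_
  rw [Real.cosh_eq, show 2 * Real.exp (-y) * ((Real.exp (y - s) + Real.exp (-(y - s))) / 2) =
    Real.exp (-y) * Real.exp (y - s) + Real.exp (-y) * Real.exp (-(y - s)) by ring,
    ← Real.exp_add, ← Real.exp_add]
  congr 2 <;> ring

theorem tendsto_laplace_poisson {a : ℂ} (ha : 0 < a.re) :
    Tendsto (fun y : ℝ => (y : ℂ) ^ (a + 1) * (2 * Complex.exp (-y) *
      ∫ t in Ioo (0 : ℝ) 1, Complex.cosh (y * t) * ((1 - t ^ 2 : ℝ) : ℂ) ^ a)) atTop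
      (𝓝 (2 ^ a * Complex.Gamma (a + 1))) := by
  set h : ℝ → ℝ → ℂ := fun y => indicator (Ioo 0 1) fun u =>
    ((2 * Real.exp (-y) * Real.cosh (y - y * u) : ℝ) : ℂ) * ((1 - (1 - u) ^ 2 : ℝ) : ℂ) ^ a with hh
  have hform : ∀ y s : ℝ, 0 < y → 0 < s → (y : ℂ) ^ a * h y (y⁻¹ * s) =
      indicator (Iio y) (fun s => ((2 * Real.exp (-y) * Real.cosh (y - s) : ℝ) : ℂ) *
        ((s * (2 - y⁻¹ * s) : ℝ) : ℂ) ^ a) s := by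
    intro y s hy hs
    have hmem : y⁻¹ * s ∈ Ioo (0 : ℝ) 1 ↔ s ∈ Iio y := by
      rw [mem_Ioo, mem_Iio, inv_mul_lt_iff₀ hy, mul_one]
      exact and_iff_right (by positivity)
    by_cases hsy : s ∈ Iio y
    · rw [hh]
      simp only
      rw [indicator_of_mem (hmem.2 hsy), indicator_of_mem hsy, mul_inv_cancel_left₀ hy.ne',
        mul_left_comm, ← Complex.mul_cpow_ofReal_nonneg hy.le, ← Complex.ofReal_mul]
      · congr 3
        field_simp
        ring
      · have := (hmem.2 hsy).1
        have := (hmem.2 hsy).2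
        nlinarith
    · rw [hh]
      simp only
      rw [indicator_of_notMem (fun h => hsy (hmem.1 h)), indicator_of_notMem hsy, mul_zero]
  have hlim : (∫ s in Ioi (0 : ℝ), ((Real.exp (-s) : ℝ) : ℂ) * ((s * 2 : ℝ) : ℂ) ^ a) =
      2 ^ a * Complex.Gamma (a + 1) := by
    rw [Complex.Gamma_eq_integral (by simp; linarith), Complex.GammaIntegral,
      ← integral_const_mul]
    refine setIntegral_congr_fun measurableSet_Ioi fun s hs => ?_
    rw [add_sub_cancel_right, Complex.ofReal_mul, Complex.mul_cpow_ofReal_nonneg (le_of_lt hs)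
      zero_le_two]
    push_cast
    ring
  have key : Tendsto (fun y : ℝ => ∫ s in Ioi (0 : ℝ), (y : ℂ) ^ a * h y (y⁻¹ * s)) atTop
      (𝓝 (∫ s in Ioi (0 : ℝ), ((Real.exp (-s) : ℝ) : ℂ) * ((s * 2 : ℝ) : ℂ) ^ a)) := by
    refine tendsto_integral_filter_of_dominated_convergence
      (fun s => 2 * 2 ^ a.re * (Real.exp (-s) * s ^ (a.re + 1 - 1))) ?_ ?_
      ((Real.GammaIntegral_convergent (by linarith)).const_mul _) ?_
    · refine .of_forall fun y => Measurable.aestronglyMeasurable ?_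
      have : Measurable (h y) := Measurable.indicator (by fun_prop) measurableSet_Ioo
      fun_prop
    · filter_upwards [eventually_gt_atTop 0] with y hy
      filter_upwards [ae_restrict_mem measurableSet_Ioi] with s hs
      have hs' : 0 < s := hs
      rw [hform y s hy hs]
      by_cases hsy : s ∈ Iio y
      · have h1 : y⁻¹ * s < 1 := by rwa [inv_mul_lt_iff₀ hy, mul_one]
        have h0 : 0 < y⁻¹ * s := by positivity
        have hr : 0 < s * (2 - y⁻¹ * s) := mul_pos hs' (by linarith)
        rw [indicator_of_mem hsy, norm_mul, Complex.norm_cpow_eq_rpow_re_of_pos hr,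
          Complex.norm_real, Real.norm_of_nonneg (by positivity), add_sub_cancel_right]
        have h2 : (s * (2 - y⁻¹ * s)) ^ a.re ≤ s ^ a.re * 2 ^ a.re := by
          rw [← Real.mul_rpow hs'.le zero_le_two]
          exact Real.rpow_le_rpow hr.le (by nlinarith) ha.le
        have h3 : 2 * Real.exp (-y) * Real.cosh (y - s) ≤ 2 * Real.exp (-s) := by
          have h4 : Real.cosh (y - s) ≤ Real.exp (y - s) := by
            have : s < y := hsy
            rw [Real.cosh_eq]
            linarith [Real.exp_le_exp.2 (show -(y - s) ≤ y - s by linarith)]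
          calc _ ≤ 2 * Real.exp (-y) * Real.exp (y - s) := by gcongr
            _ = _ := by rw [mul_assoc, ← Real.exp_add]; ring_nf
        calc _ ≤ 2 * Real.exp (-s) * (s ^ a.re * 2 ^ a.re) := by gcongr
          _ = _ := by ring
      · rw [indicator_of_notMem hsy, norm_zero]
        positivity
    · filter_upwards [ae_restrict_mem measurableSet_Ioi] with s hs
      have hs' : 0 < s := hs
      have h1 : Tendsto (fun y : ℝ => s * (2 - y⁻¹ * s)) atTop (𝓝 (s * 2)) := by
        have := ((tendsto_inv_atTop_zero.mul_const s).const_sub 2).const_mul s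
        simpa using this
      have h2 : ContinuousAt (fun r : ℝ => (r : ℂ) ^ a) (s * 2) :=
        (continuousAt_cpow_const (a := ((s * 2 : ℝ) : ℂ)) (b := a) (.inl (by
          rw [Complex.ofReal_re]; positivity))).comp (f := fun r : ℝ => (r : ℂ))
          Complex.continuous_ofReal.continuousAt
      refine (((Complex.continuous_ofReal.tendsto _).comp
        (tendsto_two_mul_exp_neg_mul_cosh_sub s)).mul (h2.tendsto.comp h1)).congr' ?_
      filter_upwards [eventually_gt_atTop s] with y hy
      rw [hform y s (hs'.trans hy) hs', indicator_of_mem (mem_Iio.2 hy)]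
      rfl
  rw [← hlim]
  refine key.congr' ?_
  filter_upwards [eventually_gt_atTop 0] with y hy
  have hy0 : (y : ℂ) ≠ 0 := by exact_mod_cast hy.ne'
  rw [integral_const_mul, integral_comp_mul_left_Ioi (h y) 0 (inv_pos.2 hy), mul_zero, inv_inv,
    Complex.real_smul, Complex.cpow_add _ _ hy0, Complex.cpow_one, mul_assoc]
  congr 2
  rw [← integral_const_mul, setIntegral_indicator measurableSet_Ioo,
    inter_eq_right.2 Ioo_subset_Ioi_self, ← integral_Ioc_eq_integral_Ioo,
    ← integral_Ioc_eq_integral_Ioo, ← intervalIntegral.integral_of_le zero_le_one,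
    ← intervalIntegral.integral_of_le zero_le_one]
  have := intervalIntegral.integral_comp_sub_left (a := 0) (b := 1) (fun t : ℝ =>
    2 * Complex.exp (-y) * (Complex.cosh (y * t) * ((1 - t ^ 2 : ℝ) : ℂ) ^ a)) 1
  rw [sub_self, sub_zero] at this
  rw [← this]
  congr 1
  funext u
  push_cast
  ring_nf

theorem tendsto_sqrt_mul_exp_neg_mul_besselI_aux {ν : ℂ} (hν : 1 / 2 < ν.re) :
    Tendsto (fun y : ℝ => (√y : ℂ) * Complex.exp (-y) * besselI ν y) atTop
      (𝓝 ((√(2 * Real.pi))⁻¹ : ℂ)) := by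
  have hg : Complex.Gamma (ν + 1 / 2) ≠ 0 :=
    Complex.Gamma_ne_zero_of_re_pos (by norm_num; linarith)
  have hpi : (√Real.pi : ℂ) ≠ 0 := by
    exact_mod_cast (Real.sqrt_pos.2 Real.pi_pos).ne'
  have h2 : (2 : ℂ) ≠ 0 := two_ne_zero
  have h := (tendsto_laplace_poisson (a := ν - 1 / 2) (by norm_num; linarith)).mul_const
    ((2 ^ ν * √Real.pi * Complex.Gamma (ν + 1 / 2))⁻¹)
  rw [show ν - 1 / 2 + 1 = ν + 1 / 2 by ring] at h
  have e : (2 : ℂ) ^ (ν - 1 / 2) * Complex.Gamma (ν + 1 / 2) *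
      (2 ^ ν * √Real.pi * Complex.Gamma (ν + 1 / 2))⁻¹ = ((√(2 * Real.pi))⁻¹ : ℂ) := by
    have h3 : (2 : ℂ) ^ (1 / 2 : ℂ) = (√2 : ℝ) := by
      rw [Real.sqrt_eq_rpow, Complex.ofReal_cpow zero_le_two]
      simp
    have h4 : ((√2 : ℝ) : ℂ) ≠ 0 := by simp
    have h5 : (2 : ℂ) ^ ν ≠ 0 := by simp [Complex.cpow_eq_zero_iff]
    rw [Complex.cpow_sub _ _ h2, h3, Real.sqrt_mul zero_le_two, Complex.ofReal_mul]
    generalize Complex.Gamma (ν + 1 / 2) = g at hg ⊢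
    field_simp
  rw [e] at h
  refine h.congr' ?_
  filter_upwards [eventually_gt_atTop 0] with y hy
  have hy0 : (y : ℂ) ≠ 0 := by exact_mod_cast hy.ne'
  have h5 : (2 : ℂ) ^ ν ≠ 0 := by simp [Complex.cpow_eq_zero_iff]
  have h6 : (y : ℂ) ^ (1 / 2 : ℂ) = (√y : ℝ) := by
    rw [Real.sqrt_eq_rpow, Complex.ofReal_cpow hy.le]
    simp
  have h7 : ((y : ℂ) / 2) ^ ν = (y : ℂ) ^ ν / 2 ^ ν := by
    have := Complex.div_cpow_ofReal_nonneg hy.le zero_le_two ν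
    simpa using this
  rw [besselI_eq ν hy, mul_right_comm 2, two_mul_integral_cosh_mul_one_sub_sq_cpow hν,
    Complex.cpow_add _ _ hy0, h6, h7]
  generalize Complex.Gamma (ν + 1 / 2) = g at hg ⊢
  field_simp

theorem tendsto_sqrt_mul_exp_neg_mul_besselI {ν : ℂ} (hν : 0 ≤ ν.re) :
    Tendsto (fun y : ℝ => (√y : ℂ) * Complex.exp (-y) * besselI ν y) atTop
      (𝓝 ((√(2 * Real.pi))⁻¹ : ℂ)) := by
  have h1 := tendsto_sqrt_mul_exp_neg_mul_besselI_aux (ν := ν + 1) (by norm_num; linarith)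
  have h2 := tendsto_sqrt_mul_exp_neg_mul_besselI_aux (ν := ν + 2) (by norm_num; linarith)
  have h3 : Tendsto (fun y : ℝ => ((y⁻¹ : ℝ) : ℂ)) atTop (𝓝 0) := by
    simpa [Function.comp_def] using (Complex.continuous_ofReal.tendsto 0).comp tendsto_inv_atTop_zero
  have h4 := h2.add ((h3.const_mul (2 * (ν + 1))).mul h1)
  rw [mul_zero, zero_mul, add_zero] at h4
  refine h4.congr' ?_
  filter_upwards [eventually_gt_atTop 0] with y hy
  rw [besselI_recurrence hν hy]
  push_cast
  ring

theorem tendsto_mul_besselK_mul_besselI (μ : ℂ) {ν : ℂ} (hν : 0 ≤ ν.re) :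
    Tendsto (fun y : ℝ => (y : ℂ) * (besselK μ y * besselI ν y)) atTop (𝓝 (1 / 2)) := by
  have h := (tendsto_sqrt_mul_exp_mul_besselK μ).mul (tendsto_sqrt_mul_exp_neg_mul_besselI hν)
  have e : (√(Real.pi / 2) : ℂ) * ((√(2 * Real.pi))⁻¹ : ℂ) = 1 / 2 := by
    have h1 : √(2 * Real.pi) = 2 * √(Real.pi / 2) := by
      rw [show 2 * Real.pi = 2 ^ 2 * (Real.pi / 2) by ring, Real.sqrt_mul (by positivity),
        Real.sqrt_sq zero_le_two]
    have h2 : (√(Real.pi / 2) : ℂ) ≠ 0 := by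
      exact_mod_cast (Real.sqrt_pos.2 (by positivity : 0 < Real.pi / 2)).ne'
    rw [h1, Complex.ofReal_mul, Complex.ofReal_ofNat]
    field_simp
  rw [e] at h
  refine h.congr' ?_
  filter_upwards [eventually_gt_atTop 0] with y hy
  have h1 : (√y : ℂ) * √y = y := by
    rw [← Complex.ofReal_mul, Real.mul_self_sqrt hy.le]
  have h2 : Complex.exp y * Complex.exp (-y) = 1 := by
    rw [← Complex.exp_add, add_neg_cancel, Complex.exp_zero]
  linear_combination (Complex.exp y * Complex.exp (-y) * besselK μ y * besselI ν y) * h1 +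
    (y * besselK μ y * besselI ν y) * h2

theorem integrableOn_besselK_mul_besselI_div (μ : ℂ) {ν : ℂ} (hν : 0 ≤ ν.re) {a : ℝ} (ha : 0 < a) :
    IntegrableOn (fun y : ℝ => besselK μ y * besselI ν y / y) (Ioi a) := by
  refine IntegrableOn.mono_set ?_ Ioi_subset_Ici_self
  refine LocallyIntegrableOn.integrableOn_of_isBigO_atTop (g := fun y : ℝ => y ^ (-2 : ℝ)) ?_ ?_
    ⟨Ioi 1, Ioi_mem_atTop 1, integrableOn_Ioi_rpow_of_lt (by norm_num) one_pos⟩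
  · refine ContinuousOn.locallyIntegrableOn (fun y hy => ContinuousAt.continuousWithinAt ?_)
      measurableSet_Ici
    have hy0 : 0 < y := ha.trans_le hy
    exact ((hasDerivAt_besselK μ hy0).continuousAt.mul
      (hasDerivAt_besselI hν hy0).continuousAt).div Complex.continuous_ofReal.continuousAt
      (by exact_mod_cast hy0.ne')
  · have h := (tendsto_mul_besselK_mul_besselI μ hν).isBigO_one ℝ
    refine Asymptotics.IsBigO.of_norm_left ?_
    refine (h.norm_left.mul (Asymptotics.isBigO_refl (fun y : ℝ => y ^ (-2 : ℝ)) atTop)).congr' ?_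
      (.of_forall fun y => one_mul _)
    filter_upwards [eventually_gt_atTop 0] with y hy
    rw [norm_mul, norm_div, Complex.norm_real, Real.norm_of_nonneg hy.le, Real.rpow_neg hy.le,
      Real.rpow_two]
    field_simp

/-- The cross-order Wronskian of `K_μ` and `I_ν` multiplied by the argument, with the derivatives
expressed by contiguous functions. -/
noncomputable def besselWronskian (μ ν : ℂ) (y : ℝ) : ℂ :=
  y * (besselK μ y * besselI (ν + 1) y) + y * (besselK (μ + 1) y * besselI ν y) +
    (ν - μ) * (besselK μ y * besselI ν y)

theorem besselWronskian_eq (μ : ℂ) {ν : ℂ} (hν : 0 ≤ ν.re) {y : ℝ} (hy : 0 < y) :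
    besselWronskian μ ν y =
      y * (besselK μ y * deriv (besselI ν) y - deriv (besselK μ) y * besselI ν y) := by
  have h0 : (y : ℂ) ≠ 0 := by exact_mod_cast hy.ne'
  rw [(hasDerivAt_besselI hν hy).deriv, (hasDerivAt_besselK μ hy).deriv, besselWronskian]
  field_simp
  ring

theorem hasDerivAt_besselWronskian (μ : ℂ) {ν : ℂ} (hν : 0 ≤ ν.re) {y : ℝ} (hy : 0 < y) :
    HasDerivAt (besselWronskian μ ν) ((ν ^ 2 - μ ^ 2) * (besselK μ y * besselI ν y / y)) y := by
  have h0 : (y : ℂ) ≠ 0 := by exact_mod_cast hy.ne'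
  have hid : HasDerivAt (fun y : ℝ => (y : ℂ)) 1 y := (hasDerivAt_id (y : ℂ)).comp_ofReal
  have hK := hasDerivAt_besselK μ hy
  have hK1 := hasDerivAt_besselK_add_one μ hy
  have hI := hasDerivAt_besselI hν hy
  have hI1 := hasDerivAt_besselI_add_one hν hy
  refine (((hid.mul (hK.mul hI1)).add (hid.mul (hK1.mul hI))).add
    ((hK.mul hI).const_mul (ν - μ))).congr_deriv ?_
  simp only [Pi.mul_apply]
  field_simp
  ring

theorem tendsto_besselWronskian (μ : ℂ) {ν : ℂ} (hν : 0 ≤ ν.re) :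
    Tendsto (besselWronskian μ ν) atTop (𝓝 1) := by
  have h1 := tendsto_mul_besselK_mul_besselI μ (ν := ν + 1) (by norm_num; linarith)
  have h2 := tendsto_mul_besselK_mul_besselI (μ + 1) hν
  have h3 : Tendsto (fun y : ℝ => ((y⁻¹ : ℝ) : ℂ)) atTop (𝓝 0) := by
    simpa [Function.comp_def] using (Complex.continuous_ofReal.tendsto 0).comp tendsto_inv_atTop_zero
  have h4 := (h1.add h2).add (((h3.mul (tendsto_mul_besselK_mul_besselI μ hν))).const_mul (ν - μ))
  norm_num at h4
  refine h4.congr' ?_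
  filter_upwards [eventually_gt_atTop 0] with y hy
  have h0 : (y : ℂ) ≠ 0 := by exact_mod_cast hy.ne'
  rw [besselWronskian, inv_mul_cancel_left₀ h0]

theorem integral_Ioi_besselK_mul_besselI_div (μ : ℂ) {ν : ℂ} (hν : 0 ≤ ν.re) {a : ℝ}
    (ha : 0 < a) :
    (ν ^ 2 - μ ^ 2) * ∫ y in Ioi a, besselK μ y * besselI ν y / y =
      1 - a * (besselK μ a * deriv (besselI ν) a - deriv (besselK μ) a * besselI ν a) := by
  rw [← besselWronskian_eq μ hν ha, ← integral_const_mul]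
  exact integral_Ioi_of_hasDerivAt_of_tendsto
    (hasDerivAt_besselWronskian μ hν ha).continuousAt.continuousWithinAt
    (fun y hy => hasDerivAt_besselWronskian μ hν (ha.trans hy))
    ((integrableOn_besselK_mul_besselI_div μ hν ha).const_mul _) (tendsto_besselWronskian μ hν)

theorem hasDerivAt_besselK_mul_besselI_sqrt (μ : ℂ) {ν : ℂ} (hν : 0 ≤ ν.re) {x : ℝ}
    (hx : 0 < x) :
    HasDerivAt (fun x : ℝ => besselK μ (√x) * besselI ν (√x))
      ((deriv (besselK μ) (√x) * besselI ν (√x) + besselK μ (√x) * deriv (besselI ν) (√x)) /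
        (2 * √x)) x := by
  have hs := Real.sqrt_pos.2 hx
  have h := ((hasDerivAt_besselK μ hs).differentiableAt.hasDerivAt.mul
    (hasDerivAt_besselI hν hs).differentiableAt.hasDerivAt).scomp x (Real.hasDerivAt_sqrt hx.ne')
  refine h.congr_deriv ?_
  rw [Complex.real_smul]
  push_cast
  ring

end

/-- evaluation of the tail integral in the proof of Theorem 2:
for `α > 0`, `τ ≠ 0` and `x > 0`,
`∫_{√x}^∞ [K_{α+iτ}(y)I_{α−iτ}(y) − K_{α−iτ}(y)I_{α+iτ}(y)] dy/y
 = i/(2ατ) + (ix/(2ατ)) d/dx[K_{α+iτ}(√x)I_{α−iτ}(√x) + K_{α−iτ}(√x)I_{α+iτ}(√x)]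
 − (i√x/(2ατ))[K_{α+iτ}(√x)I′_{α−iτ}(√x) + K_{α−iτ}(√x)I′_{α+iτ}(√x)]`. -/
theorem statement14 (α τ : ℝ) (hα : α > 0) (hτ : τ ≠ 0) :
    ∀ x : ℝ, 0 < x →
      (∫ y in Set.Ioi (Real.sqrt x),
        (besselK (α + τ * Complex.I) y * besselI (α - τ * Complex.I) y -
          besselK (α - τ * Complex.I) y * besselI (α + τ * Complex.I) y) / (y : ℂ)) =
      Complex.I / (2 * α * τ)
      + Complex.I * x / (2 * α * τ) *
          deriv (fun x' : ℝ =>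
            besselK (α + τ * Complex.I) (Real.sqrt x') *
              besselI (α - τ * Complex.I) (Real.sqrt x') +
            besselK (α - τ * Complex.I) (Real.sqrt x') *
              besselI (α + τ * Complex.I) (Real.sqrt x')) x
      - Complex.I * (Real.sqrt x : ℂ) / (2 * α * τ) *
          (besselK (α + τ * Complex.I) (Real.sqrt x) *
            deriv (besselI (α - τ * Complex.I)) (Real.sqrt x) +
          besselK (α - τ * Complex.I) (Real.sqrt x) *
            deriv (besselI (α + τ * Complex.I)) (Real.sqrt x)) := by
  intro x hx
  have hs := Real.sqrt_pos.2 hx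
  have hα0 : (α : ℂ) ≠ 0 := by exact_mod_cast hα.ne'
  have hτ0 : (τ : ℂ) ≠ 0 := by exact_mod_cast hτ
  have hs0 : (Real.sqrt x : ℂ) ≠ 0 := by exact_mod_cast hs.ne'
  have hx2 : (x : ℂ) = (Real.sqrt x : ℂ) ^ 2 := by
    rw [← Complex.ofReal_pow, Real.sq_sqrt hx.le]
  have hμ : 0 ≤ ((α : ℂ) + τ * Complex.I).re := by simpa using hα.le
  have hν : 0 ≤ ((α : ℂ) - τ * Complex.I).re := by simpa using hα.le
  have hsub : ((α : ℂ) - τ * Complex.I) ^ 2 - (α + τ * Complex.I) ^ 2 =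
      -(4 * α * τ * Complex.I) := by ring
  have h1 := integral_Ioi_besselK_mul_besselI_div (α + τ * Complex.I) hν hs
  have h2 := integral_Ioi_besselK_mul_besselI_div (α - τ * Complex.I) hμ hs
  rw [hsub] at h1
  rw [← neg_sub, hsub, neg_neg] at h2
  rw [((hasDerivAt_besselK_mul_besselI_sqrt (α + τ * Complex.I) hν hx).fun_add
    (hasDerivAt_besselK_mul_besselI_sqrt (α - τ * Complex.I) hμ hx)).deriv]
  simp only [sub_div]
  rw [MeasureTheory.integral_sub (integrableOn_besselK_mul_besselI_div _ hν hs)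
    (integrableOn_besselK_mul_besselI_div _ hμ hs)]
  generalize (∫ y in Set.Ioi (Real.sqrt x), besselK (α + τ * Complex.I) y *
    besselI (α - τ * Complex.I) y / (y : ℂ)) = A at h1 ⊢
  generalize (∫ y in Set.Ioi (Real.sqrt x), besselK (α - τ * Complex.I) y *
    besselI (α + τ * Complex.I) y / (y : ℂ)) = B at h2 ⊢
  rw [hx2]
  generalize (α : ℂ) + τ * Complex.I = μ at h1 h2 ⊢
  generalize (α : ℂ) - τ * Complex.I = ν at h1 h2 ⊢
  field_simp
  linear_combination Complex.I * (h1 + h2) + 4 * α * τ * (A - B) * Complex.I_sq
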